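/- arXiv:1702.08708 — 5 statements merged into one kernel-verified Lean document; each statement's English description precedes it below -/
import Mathlib

section
/- For every T ≥ 1/3, the function k ↦ c_ww(k;T) = sqrt((1 + T·k²)·tanh k / k) is strictly increasing on the interval (0,∞); in particular, for every k > 0 and every integer n ≥ 2 one has c_ww(k;T) < c_ww(n·k;T). -/
open Real Filter Set

/-- The water-wave phase speed with surface tension coefficient `T`:
`c_ww(k;T) = sqrt((1 + T k²) tanh k / k)` for `k ≠ 0`, extended by `c_ww(0;T) = 1`. -/
noncomputable def cwwT (T k : ℝ) : ℝ :=
  if k = 0 then 1 else Real.sqrt ((1 + T * k ^ 2) * Real.tanh k / k)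

/-- A function vanishing at `0` with positive derivative on `(0,∞)` is positive on `(0,∞)`. -/
lemma pos_of_hasDerivAt_pos {f f' : ℝ → ℝ} (hf : ∀ x, HasDerivAt f (f' x) x) (h0 : f 0 = 0)
    (hpos : ∀ x, 0 < x → 0 < f' x) (x : ℝ) (hx : 0 < x) : 0 < f x := by
  have hmono : StrictMonoOn f (Ici 0) := by
    refine strictMonoOn_of_deriv_pos (convex_Ici 0)
      (fun y _ => (hf y).continuousAt.continuousWithinAt) fun y hy => ?_
    rw [interior_Ici] at hy
    rw [(hf y).deriv]
    exact hpos y hy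
  simpa [h0] using hmono self_mem_Ici hx.le hx

/-- The Padé-type bound `(12 - x²) sinh x < x³ + 12 x` for `x > 0`. -/
lemma sinh_pade_pos (x : ℝ) (hx : 0 < x) :
    0 < (x ^ 2 - 12) * sinh x + x ^ 3 + 12 * x := by
  have hid := fun y : ℝ => hasDerivAt_id' y
  have hs := fun y : ℝ => hasDerivAt_sinh y
  have hc := fun y : ℝ => hasDerivAt_cosh y
  have h4 : ∀ y : ℝ, 0 < y → 0 < y ^ 2 * sinh y + 8 * y * cosh y := fun y hy => by
    have := sinh_pos_iff.2 hy
    have := cosh_pos y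
    positivity
  have h3 := pos_of_hasDerivAt_pos
    (f := fun y => (y ^ 2 - 6) * cosh y + 6 * y * sinh y + 6)
    (fun y => ((((((hid y).pow 2).sub_const 6).mul (hc y)).add
      (((hid y).const_mul 6).mul (hs y))).add_const 6).congr_deriv
        (by simp; ring)) (by norm_num) h4
  have h2 := pos_of_hasDerivAt_pos
    (f := fun y => (y ^ 2 - 10) * sinh y + 4 * y * cosh y + 6 * y)
    (fun y => ((((((hid y).pow 2).sub_const 10).mul (hs y)).add
      (((hid y).const_mul 4).mul (hc y))).add ((hid y).const_mul 6)).congr_deriv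
        (by simp; ring)) (by norm_num) h3
  have h1 := pos_of_hasDerivAt_pos
    (f := fun y => 2 * y * sinh y + (y ^ 2 - 12) * cosh y + 3 * y ^ 2 + 12)
    (fun y => ((((((hid y).const_mul 2).mul (hs y)).add
      ((((hid y).pow 2).sub_const 12).mul (hc y))).add
        (((hid y).pow 2).const_mul 3)).add_const 12).congr_deriv
        (by simp; ring)) (by norm_num) h2
  exact pos_of_hasDerivAt_pos
    (f := fun y => (y ^ 2 - 12) * sinh y + y ^ 3 + 12 * y)
    (fun y => ((((((hid y).pow 2).sub_const 12).mul (hs y)).add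
      ((hid y).pow 3)).add ((hid y).const_mul 12)).congr_deriv
        (by simp)) (by norm_num) h1 x hx

/-- The squared phase speed is strictly increasing on `(0,∞)` when `T ≥ 1/3`. -/
lemma strictMonoOn_mul_tanh_div {T : ℝ} (hT : 1 / 3 ≤ T) :
    StrictMonoOn (fun k : ℝ => (1 + T * k ^ 2) * tanh k / k) (Ioi 0) := by
  have hd : ∀ k : ℝ, 0 < k → HasDerivAt (fun k : ℝ => (1 + T * k ^ 2) * tanh k / k)
      ((k + T * k ^ 3 + (T * k ^ 2 - 1) * (sinh k * cosh k)) / (k * cosh k) ^ 2) k := by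
    intro k hk
    have hc := (cosh_pos k).ne'
    have h := (((((hasDerivAt_id' k).pow 2).const_mul T).const_add 1).mul
      ((hasDerivAt_sinh k).div (hasDerivAt_cosh k) hc)).div (hasDerivAt_id' k) hk.ne'
    have hfun : (fun k : ℝ => (1 + T * k ^ 2) * tanh k / k) =
        fun k : ℝ => (1 + T * k ^ 2) * (sinh k / cosh k) / k := by
      simp only [tanh_eq_sinh_div_cosh]
    rw [hfun]
    refine h.congr_deriv ?_
    simp
    field_simp
    linear_combination (k + T * k ^ 3) * cosh_sq k
  refine strictMonoOn_of_deriv_pos (convex_Ioi 0)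
    (fun k hk => (hd k hk).continuousAt.continuousWithinAt) fun k hk => ?_
  rw [interior_Ioi] at hk
  have hk : 0 < k := hk
  rw [(hd k hk).deriv]
  have hs := sinh_pos_iff.2 hk
  have hc := cosh_pos k
  have hp := sinh_pade_pos (2 * k) (by positivity)
  rw [sinh_two_mul] at hp
  have hq : 0 ≤ (T - 1 / 3) * (k ^ 2 * (sinh k * cosh k + k)) :=
    mul_nonneg (sub_nonneg.2 hT) (by positivity)
  have hnum : 0 < k + T * k ^ 3 + (T * k ^ 2 - 1) * (sinh k * cosh k) := by
    linarith
  positivity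

/-- For every `T ≥ 1/3`, `c_ww(·;T)` is strictly increasing on `(0,∞)`; in particular,
for every `k > 0` and integer `n ≥ 2`, `c_ww(k;T) < c_ww(n k;T)`. -/
theorem cwwT_strictMonoOn (T : ℝ) (hT : 1 / 3 ≤ T) :
    StrictMonoOn (cwwT T) (Set.Ioi (0 : ℝ)) ∧
      ∀ k : ℝ, 0 < k → ∀ n : ℤ, 2 ≤ n → cwwT T k < cwwT T ((n : ℝ) * k) := by
  have hmono : StrictMonoOn (cwwT T) (Ioi 0) := by
    intro a ha b hb hab
    have ha : 0 < a := ha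
    have hb : 0 < b := hb
    have hta : 0 ≤ tanh a := by
      rw [tanh_eq_sinh_div_cosh]
      exact div_nonneg (sinh_nonneg_iff.2 ha.le) (cosh_pos a).le
    simp only [cwwT, ha.ne', hb.ne', if_false]
    have hT0 : 0 ≤ T := by linarith
    exact sqrt_lt_sqrt (by positivity) (strictMonoOn_mul_tanh_div hT ha hb hab)
  refine ⟨hmono, fun k hk n hn => ?_⟩
  have hn : (2 : ℝ) ≤ n := by exact_mod_cast hn
  have hkn : k < n * k := by nlinarith
  exact hmono hk (hk.trans hkn) hkn
end

section
/- For every T with 0 < T < 1/3 and every integer n ≥ 2, there exists k > 0 such that c_ww(k;T) = c_ww(n·k;T), i.e. (1 + T·k²)·tanh(k)/k = (1 + T·n²·k²)·tanh(n·k)/(n·k); that is, the resonance of the fundamental mode and the n-th harmonic occurs for some wave number. -/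
open Real Filter Set

theorem hasDerivAt_tanh (x : ℝ) : HasDerivAt Real.tanh (1 - Real.tanh x ^ 2) x := by
  have hc : Real.cosh x ≠ 0 := (Real.cosh_pos x).ne'
  have h := (Real.hasDerivAt_sinh x).div (Real.hasDerivAt_cosh x) hc
  have hf : Real.sinh / Real.cosh = Real.tanh :=
    funext fun y => (Real.tanh_eq_sinh_div_cosh y).symm
  rw [hf] at h
  refine h.congr_deriv ?_
  rw [Real.tanh_eq_sinh_div_cosh]
  field_simp

theorem le_of_hasDerivAt_le_of_nonneg {f g f' g' : ℝ → ℝ}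
    (hf : ∀ x, HasDerivAt f (f' x) x) (hg : ∀ x, HasDerivAt g (g' x) x)
    (h0 : f 0 ≤ g 0) (h : ∀ x, 0 < x → f' x ≤ g' x) {x : ℝ} (hx : 0 ≤ x) : f x ≤ g x := by
  have hd : ∀ y, HasDerivAt (fun y => g y - f y) (g' y - f' y) y := fun y => (hg y).sub (hf y)
  have hm : MonotoneOn (fun y => g y - f y) (Ici 0) := by
    refine monotoneOn_of_deriv_nonneg (convex_Ici 0)
      (fun y _ => (hd y).continuousAt.continuousWithinAt)
      (fun y _ => (hd y).differentiableAt.differentiableWithinAt) fun y hy => ?_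
    rw [interior_Ici] at hy
    rw [(hd y).deriv]
    exact sub_nonneg.2 (h y hy)
  have := hm (mem_Ici.2 le_rfl) (mem_Ici.2 hx) hx
  simp only at this
  linarith

theorem tanh_monotone : Monotone Real.tanh :=
  monotone_of_deriv_nonneg (fun x => (hasDerivAt_tanh x).differentiableAt) fun x => by
    rw [(hasDerivAt_tanh x).deriv]
    linarith [Real.tanh_sq_lt_one x]

theorem tanh_pos {x : ℝ} (hx : 0 < x) : 0 < Real.tanh x := by
  rw [Real.tanh_eq_sinh_div_cosh]
  exact div_pos (Real.sinh_pos_iff.2 hx) (Real.cosh_pos x)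

theorem tanh_le_self {x : ℝ} (hx : 0 ≤ x) : Real.tanh x ≤ x :=
  le_of_hasDerivAt_le_of_nonneg hasDerivAt_tanh hasDerivAt_id (by simp)
    (fun y _ => by linarith [sq_nonneg (Real.tanh y)]) hx

theorem sub_cube_div_three_le_tanh {x : ℝ} (hx : 0 ≤ x) : x - x ^ 3 / 3 ≤ Real.tanh x := by
  refine le_of_hasDerivAt_le_of_nonneg (f := fun y => y - y ^ 3 / 3) (f' := fun y => 1 - y ^ 2)
    (fun y => ?_) hasDerivAt_tanh (by simp) (fun y hy => ?_) hx
  · exact ((hasDerivAt_id y).sub ((hasDerivAt_pow 3 y).div_const 3)).congr_deriv (by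
      push_cast; ring)
  · have := pow_le_pow_left₀ (tanh_pos hy).le (tanh_le_self hy.le) 2
    linarith

theorem tanh_le_quintic {x : ℝ} (hx : 0 ≤ x) :
    Real.tanh x ≤ x - x ^ 3 / 3 + 2 * x ^ 5 / 15 := by
  refine le_of_hasDerivAt_le_of_nonneg (g := fun y => y - y ^ 3 / 3 + 2 * y ^ 5 / 15)
    (g' := fun y => 1 - y ^ 2 + 2 * y ^ 4 / 3)
    hasDerivAt_tanh (fun y => ?_) (by simp) (fun y hy => ?_) hx
  · exact (((hasDerivAt_id y).sub ((hasDerivAt_pow 3 y).div_const 3)).add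
      (((hasDerivAt_pow 5 y).const_mul 2).div_const 15)).congr_deriv (by push_cast; ring)
  · rcases le_total (y ^ 2) (3 / 2) with h | h
    · have h0 : 0 ≤ y - y ^ 3 / 3 := by nlinarith
      have := pow_le_pow_left₀ h0 (sub_cube_div_three_le_tanh hy.le) 2
      nlinarith [sq_nonneg (y ^ 3)]
    · nlinarith [sq_nonneg (Real.tanh y)]

/-- The `n`-th harmonic is slower than the fundamental mode at some small wave number. -/
theorem exists_harmonic_slower {T N : ℝ} (hT0 : 0 < T) (hT : T < 1 / 3) (hN : 2 ≤ N) :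
    ∃ k, 0 < k ∧
      (1 + T * N ^ 2 * k ^ 2) * Real.tanh (N * k) < N * ((1 + T * k ^ 2) * Real.tanh k) := by
  have hd : 0 < 1 / 3 - T := by linarith
  have hN0 : 0 < N := by linarith
  set k := √(1 / 3 - T) / N ^ 2 with hkdef
  have hk : 0 < k := div_pos (Real.sqrt_pos.2 hd) (by positivity)
  have hk2 : k ^ 2 * N ^ 4 = 1 / 3 - T := by
    rw [hkdef, div_pow, Real.sq_sqrt hd.le]
    field_simp
  refine ⟨k, hk, ?_⟩
  have hy : N ^ 2 * k ^ 2 ≤ 1 := by nlinarith [mul_pos (pow_pos hN0 2) (pow_pos hk 2)]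
  have hu := mul_le_mul_of_nonneg_left (tanh_le_quintic (mul_pos hN0 hk).le)
    (by positivity : 0 ≤ 1 + T * N ^ 2 * k ^ 2)
  have hl := mul_le_mul_of_nonneg_left (mul_le_mul_of_nonneg_left
    (sub_cube_div_three_le_tanh hk.le) (by positivity : 0 ≤ 1 + T * k ^ 2)) hN0.le
  refine hu.trans_lt (lt_of_lt_of_le ?_ hl)
  have hid : N * ((1 + T * k ^ 2) * (k - k ^ 3 / 3)) - (1 + T * N ^ 2 * k ^ 2) *
      (N * k - (N * k) ^ 3 / 3 + 2 * (N * k) ^ 5 / 15) =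
      N * k ^ 3 * ((1 / 3 - T) * (N ^ 2 - 1) + T / 3 * (k ^ 2 * (N ^ 4 - 1))
        - k ^ 2 * N ^ 4 * (2 / 15 * (1 + T * (N ^ 2 * k ^ 2)))) := by ring
  have hq : 0 ≤ T / 3 * (k ^ 2 * (N ^ 4 - 1)) := by
    have : 1 ≤ N ^ 4 := one_le_pow₀ (by linarith)
    have : 0 ≤ N ^ 4 - 1 := by linarith
    positivity
  have hr : T * (N ^ 2 * k ^ 2) ≤ T := mul_le_of_le_one_right hT0.le hy
  rw [hk2] at hid
  have hpos : 0 < (1 / 3 - T) * (N ^ 2 - 1) + T / 3 * (k ^ 2 * (N ^ 4 - 1))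
      - (1 / 3 - T) * (2 / 15 * (1 + T * (N ^ 2 * k ^ 2))) := by
    have : 0 < N ^ 2 - 1 - 2 / 15 * (1 + T * (N ^ 2 * k ^ 2)) := by nlinarith
    nlinarith [mul_pos hd this]
  have := mul_pos (by positivity : 0 < N * k ^ 3) hpos
  linarith

/-- The `n`-th harmonic is faster than the fundamental mode at the wave number `1 / √T`. -/
theorem exists_harmonic_faster {T N : ℝ} (hT0 : 0 < T) (hN : 2 ≤ N) :
    ∃ k, 0 < k ∧
      N * ((1 + T * k ^ 2) * Real.tanh k) < (1 + T * N ^ 2 * k ^ 2) * Real.tanh (N * k) := by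
  have hk : 0 < 1 / √T := by positivity
  refine ⟨1 / √T, hk, ?_⟩
  have hTk : T * (1 / √T) ^ 2 = 1 := by
    rw [div_pow, Real.sq_sqrt hT0.le]
    field_simp
  have hm : Real.tanh (1 / √T) ≤ Real.tanh (N * (1 / √T)) := tanh_monotone (by nlinarith)
  have hp := tanh_pos hk
  rw [hTk, mul_right_comm, hTk]
  nlinarith [mul_pos hp (by nlinarith : 0 < (N - 1) ^ 2)]

/-- For `0 < T < 1/3` and every integer `n ≥ 2`, there exists `k > 0` with
`c_ww(k;T) = c_ww(n k;T)`, i.e.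
`(1 + T k²) tanh k / k = (1 + T n² k²) tanh(n k)/(n k)`: the resonance of the
fundamental mode and the `n`-th harmonic occurs for some wave number. -/
theorem cwwT_harmonic_resonance (T : ℝ) (hT0 : 0 < T) (hT : T < 1 / 3)
    (n : ℤ) (hn : 2 ≤ n) :
    ∃ k : ℝ, 0 < k ∧ cwwT T k = cwwT T ((n : ℝ) * k) ∧
      (1 + T * k ^ 2) * Real.tanh k / k =
        (1 + T * (n : ℝ) ^ 2 * k ^ 2) * Real.tanh ((n : ℝ) * k) / ((n : ℝ) * k) := by
  have hN : (2 : ℝ) ≤ n := by exact_mod_cast hn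
  have hcont : Continuous Real.tanh :=
    continuous_iff_continuousAt.2 fun x => (hasDerivAt_tanh x).continuousAt
  obtain ⟨a, ha, hfa⟩ := exists_harmonic_slower hT0 hT hN
  obtain ⟨b, hb, hfb⟩ := exists_harmonic_faster hT0 hN
  obtain ⟨k, hk, hEq⟩ := (isPreconnected_Ioi (a := (0 : ℝ))).intermediate_value₂
    (f := fun k => (1 + T * (n : ℝ) ^ 2 * k ^ 2) * Real.tanh (n * k))
    (g := fun k => n * ((1 + T * k ^ 2) * Real.tanh k)) ha hb
    (by fun_prop) (by fun_prop) hfa.le hfb.le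
  have hk0 : 0 < k := hk
  have hn0 : (0 : ℝ) < n := by linarith
  have key : (1 + T * k ^ 2) * Real.tanh k / k =
      (1 + T * (n : ℝ) ^ 2 * k ^ 2) * Real.tanh ((n : ℝ) * k) / ((n : ℝ) * k) := by
    rw [hEq, mul_div_mul_left _ _ hn0.ne']
  refine ⟨k, hk0, ?_, key⟩
  rw [cwwT, cwwT, if_neg hk0.ne', if_neg (mul_pos hn0 hk0).ne', key, mul_pow, mul_assoc T]
end

section
/- For every k > 0, the derivative at k of the function k ↦ sqrt(k·tanh k) is strictly less than 1; equivalently, i₂(k) := (k·c_ww(k;0))' − 1 < 0 for all k > 0, i.e. the linear group speed is everywhere less than the long-wave phase speed 1. -/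
open Real Filter Set

theorem sinh_sq_add_sq_lt {x : ℝ} (hx : 0 < x) :
    sinh x ^ 2 + x ^ 2 < 2 * x * (sinh x * cosh x) := by
  have hderiv : ∀ y : ℝ, HasDerivAt
      (fun y : ℝ => 2 * y * (sinh y * cosh y) - sinh y ^ 2 - y ^ 2)
      (4 * y * sinh y ^ 2) y := by
    intro y
    have h := ((((hasDerivAt_id y).const_mul 2).mul
      ((hasDerivAt_sinh y).mul (hasDerivAt_cosh y))).sub
      ((hasDerivAt_sinh y).pow 2)).sub ((hasDerivAt_id y).pow 2)
    refine h.congr_deriv ?_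
    simp only [id, Pi.mul_apply]
    push_cast
    linear_combination (2 * y) * cosh_sq y
  have hmono : StrictMonoOn
      (fun y : ℝ => 2 * y * (sinh y * cosh y) - sinh y ^ 2 - y ^ 2) (Ici 0) := by
    refine strictMonoOn_of_deriv_pos (convex_Ici 0)
      (fun y _ => (hderiv y).continuousAt.continuousWithinAt) fun y hy => ?_
    rw [interior_Ici, mem_Ioi] at hy
    rw [(hderiv y).deriv]
    have := sinh_pos_iff.mpr hy
    positivity
  have h := hmono self_mem_Ici hx.le hx
  simp only [sinh_zero] at h
  linarith

theorem hasDerivAt_real_tanh (x : ℝ) : HasDerivAt tanh (1 / cosh x ^ 2) x := by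
  have h := (hasDerivAt_sinh x).div (hasDerivAt_cosh x) (cosh_pos x).ne'
  have heq : tanh = sinh / cosh := funext tanh_eq_sinh_div_cosh
  rw [heq]
  refine h.congr_deriv ?_
  congr 1
  linear_combination cosh_sq x

/-- For every `k > 0`, `i₂(k) := (k c_ww(k;0))' − 1 < 0`, where
`k c_ww(k;0) = sqrt(k tanh k)`; i.e. the linear group speed is everywhere
less than the long-wave phase speed `1`. -/
theorem groupSpeed_lt_one :
    ∀ k : ℝ, 0 < k →
      deriv (fun k : ℝ => Real.sqrt (k * Real.tanh k)) k < 1 := by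
  intro k hk
  have hs : 0 < sinh k := sinh_pos_iff.mpr hk
  have hc : 0 < cosh k := cosh_pos k
  have hpos : 0 < k * tanh k := by
    rw [tanh_eq_sinh_div_cosh]
    positivity
  have hd : HasDerivAt (fun k : ℝ => √(k * tanh k))
      ((1 * tanh k + k * (1 / cosh k ^ 2)) / (2 * √(k * tanh k))) k :=
    ((hasDerivAt_id k).mul (hasDerivAt_real_tanh k)).sqrt hpos.ne'
  rw [hd.deriv, div_lt_one (by positivity)]
  refine lt_of_pow_lt_pow_left₀ 2 (by positivity) ?_
  rw [mul_pow, sq_sqrt hpos.le, tanh_eq_sinh_div_cosh]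
  have hnum : (sinh k * cosh k + k) ^ 2 < 4 * k * sinh k * cosh k ^ 3 := by
    have h := sinh_sq_add_sq_lt (x := 2 * k) (by positivity)
    rw [sinh_two_mul, cosh_two_mul, sinh_sq] at h
    linarith
  have hl : (1 * (sinh k / cosh k) + k * (1 / cosh k ^ 2)) ^ 2
      = (sinh k * cosh k + k) ^ 2 / cosh k ^ 4 := by
    field_simp
  have hr : 2 ^ 2 * (k * (sinh k / cosh k))
      = 4 * k * sinh k * cosh k ^ 3 / cosh k ^ 4 := by
    field_simp
    norm_num
  rw [hl, hr]
  gcongr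
end

section
/- With i₄ the modulational-instability index of the full-dispersion Camassa–Holm equation without surface tension, i₄(k) tends to −∞ as k → ∞. -/
open Real Filter Set Topology

/-- The water-wave phase speed without surface tension: `c_ww(k;0) = sqrt(tanh k / k)`
for `k ≠ 0`, extended by `c_ww(0;0) = 1`. -/
noncomputable def cww0 (k : ℝ) : ℝ := if k = 0 then 1 else Real.sqrt (Real.tanh k / k)

/-- `i₁(k) = (k c_ww(k;0))''`, the second derivative of `k ↦ sqrt(k tanh k)`. -/
noncomputable def i1 (k : ℝ) : ℝ :=
  deriv (deriv fun k : ℝ => Real.sqrt (k * Real.tanh k)) k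

/-- `i₂(k) = (k c_ww(k;0))' − 1`. -/
noncomputable def i2 (k : ℝ) : ℝ :=
  deriv (fun k : ℝ => Real.sqrt (k * Real.tanh k)) k - 1

/-- `i₃(k) = c_ww(k;0) − c_ww(2k;0)`. -/
noncomputable def i3 (k : ℝ) : ℝ := cww0 k - cww0 (2 * k)

/-- The fourth modulational-instability index of the full-dispersion Camassa–Holm
equation without surface tension. -/
noncomputable def i4 (k : ℝ) : ℝ :=
  3 * i2 k - i2 k * i3 k + 6 * i3 k - 1 / 12 * k ^ 2 * (57 * i2 k + 34 * i3 k) +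
    1 / 108 * k ^ 4 * (198 * i2 k + 35 * i3 k)


lemma Real.hasDerivAt_tanh_inv_cosh_sq (x : ℝ) : HasDerivAt Real.tanh (1 / Real.cosh x ^ 2) x := by
  have h := (Real.hasDerivAt_sinh x).div (Real.hasDerivAt_cosh x) (Real.cosh_pos x).ne'
  have e : (Real.sinh / Real.cosh : ℝ → ℝ) = Real.tanh := by
    funext y
    exact (Real.tanh_eq_sinh_div_cosh y).symm
  rw [e] at h
  rwa [← sq, ← sq, Real.cosh_sq_sub_sinh_sq] at h

lemma Real.half_le_tanh {x : ℝ} (hx : 1 ≤ x) : 1 / 2 ≤ Real.tanh x := by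
  have h₁ : x ≤ Real.sinh x := Real.self_le_sinh_iff.2 (by linarith)
  have h₂ : Real.exp (-x) ≤ 1 := Real.exp_le_one_iff.2 (by linarith)
  have h₃ := Real.cosh_sub_sinh x
  rw [Real.tanh_eq_sinh_div_cosh, div_le_div_iff₀ two_pos (Real.cosh_pos x)]
  linarith

lemma Real.self_div_cosh_sq_le_one {x : ℝ} (hx : 0 ≤ x) : x / Real.cosh x ^ 2 ≤ 1 := by
  have h₁ : x ≤ Real.sinh x := Real.self_le_sinh_iff.2 hx
  rw [div_le_one (by positivity), Real.cosh_sq]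
  nlinarith [sq_nonneg (x - 1)]

lemma deriv_sqrt_mul_tanh {x : ℝ} (hx : 1 ≤ x) :
    deriv (fun k : ℝ => Real.sqrt (k * Real.tanh k)) x =
      (Real.tanh x + x / Real.cosh x ^ 2) / (2 * Real.sqrt (x * Real.tanh x)) := by
  have ht := Real.half_le_tanh hx
  have h := ((hasDerivAt_id x).mul (Real.hasDerivAt_tanh_inv_cosh_sq x)).sqrt
    (by simpa using ⟨by linarith, by linarith⟩)
  refine Eq.trans h.deriv ?_
  simp [div_eq_mul_inv]

lemma tendsto_sqrt_mul_tanh_atTop :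
    Tendsto (fun k : ℝ => Real.sqrt (k * Real.tanh k)) atTop atTop := by
  refine Real.tendsto_sqrt_atTop.comp
    (tendsto_atTop_mono' atTop ?_ (tendsto_id.atTop_mul_const (show (0 : ℝ) < 1 / 2 by norm_num)))
  filter_upwards [eventually_ge_atTop 1] with k hk
  exact mul_le_mul_of_nonneg_left (Real.half_le_tanh hk) (zero_le_one.trans hk)

lemma tendsto_i2_atTop : Tendsto i2 atTop (𝓝 (-1)) := by
  have h : Tendsto (deriv fun k : ℝ => Real.sqrt (k * Real.tanh k)) atTop (𝓝 0) := by
    refine squeeze_zero' ?_ ?_ (tendsto_inv_atTop_zero.comp tendsto_sqrt_mul_tanh_atTop)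
    · filter_upwards [eventually_ge_atTop 1] with k hk
      have ht := Real.half_le_tanh hk
      rw [deriv_sqrt_mul_tanh hk]
      positivity
    · filter_upwards [eventually_ge_atTop 1] with k hk
      have ht := Real.half_le_tanh hk
      have hs : 0 < Real.sqrt (k * Real.tanh k) :=
        Real.sqrt_pos.2 (mul_pos (by linarith) (by linarith))
      have hc := Real.self_div_cosh_sq_le_one (x := k) (by linarith)
      have hl := (Real.tanh_lt_one k).le
      rw [deriv_sqrt_mul_tanh hk, Function.comp_apply, inv_eq_one_div,
        div_le_div_iff₀ (by positivity) hs]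
      nlinarith
  have hsub := h.sub_const 1
  rwa [zero_sub] at hsub

lemma tendsto_cww0_atTop : Tendsto cww0 atTop (𝓝 0) := by
  have h : Tendsto (fun k : ℝ => Real.sqrt k⁻¹) atTop (𝓝 0) := by
    simpa [Function.comp_def] using (Real.continuous_sqrt.tendsto 0).comp tendsto_inv_atTop_zero
  refine squeeze_zero' ?_ ?_ h
  · filter_upwards [eventually_gt_atTop 0] with k hk
    simp [cww0, hk.ne']
  · filter_upwards [eventually_gt_atTop 0] with k hk
    rw [cww0, if_neg hk.ne', inv_eq_one_div]
    gcongr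
    exact (Real.tanh_lt_one k).le

lemma tendsto_i3_atTop : Tendsto i3 atTop (𝓝 0) := by
  have h := tendsto_cww0_atTop.comp (tendsto_id.const_mul_atTop (two_pos (α := ℝ)))
  have hsub := tendsto_cww0_atTop.sub h
  rwa [sub_zero] at hsub

/-- `i₄(k) → −∞` as `k → ∞`. -/
theorem i4_tendsto_atBot :
    Filter.Tendsto i4 Filter.atTop Filter.atBot := by
  have hinv : Tendsto (fun k : ℝ => k⁻¹) atTop (𝓝 0) := tendsto_inv_atTop_zero
  have h₂ := tendsto_i2_atTop
  have h₃ := tendsto_i3_atTop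
  have hlim : Tendsto (fun k : ℝ =>
      (3 * i2 k - i2 k * i3 k + 6 * i3 k) * k⁻¹ ^ 4
        - 1 / 12 * (57 * i2 k + 34 * i3 k) * k⁻¹ ^ 2
        + 1 / 108 * (198 * i2 k + 35 * i3 k)) atTop (𝓝 (-(11 / 6))) := by
    convert (((((h₂.const_mul 3).sub (h₂.mul h₃)).add (h₃.const_mul 6)).mul (hinv.pow 4)).sub
      ((((h₂.const_mul 57).add (h₃.const_mul 34)).const_mul (1 / 12)).mul (hinv.pow 2))).add
      (((h₂.const_mul 198).add (h₃.const_mul 35)).const_mul (1 / 108)) using 2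
    norm_num
  refine ((tendsto_pow_atTop (α := ℝ) four_ne_zero).atTop_mul_neg (by norm_num) hlim).congr' ?_
  filter_upwards [eventually_ne_atTop 0] with k hk
  rw [i4]
  field_simp
end

section
/- For the Camassa–Holm modulational-instability index Δ_CH(k) := i₁(k)·i₂(k)·i₄(k)/i₃(k), one has (i₂(k)·i₄(k))/i₃(k) < 0 for every k > 0, and consequently Δ_CH(k) > 0 for 0 < k < 6 and Δ_CH(k) < 0 for k > 6; hence a sufficiently small 2π/k-periodic traveling wave of the Camassa–Holm equation is modulationally unstable if k > 6. -/
open Real Filter Set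

/-- The Camassa–Holm dispersion symbol (with `a = 1/12`, after normalization):
`c_CH(k) = (12 − k²)/(12 + k²)`. -/
noncomputable def cCH (k : ℝ) : ℝ := (12 - k ^ 2) / (12 + k ^ 2)

/-- `i₁(k) = (k c_CH(k))''`. -/
noncomputable def i1CH (k : ℝ) : ℝ := deriv (deriv fun k : ℝ => k * cCH k) k

/-- `i₂(k) = (k c_CH(k))' − 1`. -/
noncomputable def i2CH (k : ℝ) : ℝ := deriv (fun k : ℝ => k * cCH k) k - 1

/-- `i₃(k) = c_CH(k) − c_CH(2k)`. -/
noncomputable def i3CH (k : ℝ) : ℝ := cCH k - cCH (2 * k)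

/-- The fourth Camassa–Holm modulational-instability index. -/
noncomputable def i4CH (k : ℝ) : ℝ :=
  1296 * (cCH (2 * k) * i2CH k + 2 * i3CH k) - 432 * i2CH k * i3CH k -
    1512 * k ^ 2 * cCH (2 * k) * i2CH k +
    49 * k ^ 4 * (9 * cCH (2 * k) * i2CH k - 2 * i3CH k)

/-- The Camassa–Holm modulational-instability index `Δ_CH(k) = i₁ i₂ i₄ / i₃`. -/
noncomputable def deltaCH (k : ℝ) : ℝ := i1CH k * i2CH k * i4CH k / i3CH k

theorem hasDerivAt_mul_cCH (k : ℝ) :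
    HasDerivAt (fun k : ℝ => k * cCH k) (24 * (12 - k ^ 2) / (12 + k ^ 2) ^ 2 - 1) k := by
  have hk : 12 + k ^ 2 ≠ 0 := by positivity
  have hsq : HasDerivAt (fun k : ℝ => k ^ 2) (2 * k) k := by
    simpa using hasDerivAt_pow 2 k
  have h := (hasDerivAt_id k).mul ((hsq.const_sub 12).div (hsq.const_add 12) hk)
  refine h.congr_deriv ?_
  simp only [id, Pi.div_apply]
  field_simp
  ring

theorem deriv_mul_cCH :
    deriv (fun k : ℝ => k * cCH k) =
      fun k : ℝ => 24 * (12 - k ^ 2) / (12 + k ^ 2) ^ 2 - 1 :=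
  funext fun k => (hasDerivAt_mul_cCH k).deriv

theorem i1CH_eq (k : ℝ) : i1CH k = 48 * k * (k ^ 2 - 36) / (12 + k ^ 2) ^ 3 := by
  have hk : 12 + k ^ 2 ≠ 0 := by positivity
  have hsq : HasDerivAt (fun k : ℝ => k ^ 2) (2 * k) k := by
    simpa using hasDerivAt_pow 2 k
  have h := ((((hsq.const_sub 12).const_mul 24).div ((hsq.const_add 12).pow 2)
    (pow_ne_zero 2 hk)).sub_const 1)
  rw [i1CH, deriv_mul_cCH]
  refine (h.congr_deriv ?_).deriv
  simp only [Pi.pow_apply]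
  field_simp
  ring

theorem i2CH_eq (k : ℝ) : i2CH k = -(2 * k ^ 2 * (k ^ 2 + 36)) / (12 + k ^ 2) ^ 2 := by
  have hk : 12 + k ^ 2 ≠ 0 := by positivity
  rw [i2CH, deriv_mul_cCH]
  field_simp
  ring

theorem cCH_two_mul (k : ℝ) : cCH (2 * k) = (3 - k ^ 2) / (3 + k ^ 2) := by
  have h₁ : 12 + (2 * k) ^ 2 ≠ 0 := by positivity
  have h₂ : 3 + k ^ 2 ≠ 0 := by positivity
  rw [cCH, div_eq_div_iff h₁ h₂]
  ring

theorem i3CH_eq (k : ℝ) : i3CH k = 18 * k ^ 2 / ((12 + k ^ 2) * (3 + k ^ 2)) := by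
  have h₁ : 12 + k ^ 2 ≠ 0 := by positivity
  have h₂ : 3 + k ^ 2 ≠ 0 := by positivity
  rw [i3CH, cCH_two_mul, cCH]
  field_simp
  ring

theorem i4CH_eq (k : ℝ) :
    i4CH k = 18 * k ^ 2 *
      ((49 * (k ^ 2) ^ 4 + 1351 * (k ^ 2) ^ 3 - 11868 * (k ^ 2) ^ 2 + 25488 * k ^ 2 + 15552) *
        (12 + k ^ 2) + 864 * k ^ 2 * (k ^ 2 + 36)) /
      ((12 + k ^ 2) ^ 3 * (3 + k ^ 2)) := by
  have h₁ : 12 + k ^ 2 ≠ 0 := by positivity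
  have h₂ : 3 + k ^ 2 ≠ 0 := by positivity
  rw [i4CH, i2CH_eq, i3CH_eq, cCH_two_mul]
  field_simp
  ring

theorem quartic_pos {x : ℝ} (hx : 0 ≤ x) :
    0 < 49 * x ^ 4 + 1351 * x ^ 3 - 11868 * x ^ 2 + 25488 * x + 15552 := by
  nlinarith [mul_nonneg hx (sq_nonneg (x - 43 / 10)), sq_nonneg (x ^ 2 - 5 / 2)]

theorem i4CH_pos {k : ℝ} (hk : 0 < k) : 0 < i4CH k := by
  have := quartic_pos (sq_nonneg k)
  rw [i4CH_eq]
  positivity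

theorem i3CH_pos {k : ℝ} (hk : 0 < k) : 0 < i3CH k := by
  rw [i3CH_eq]
  positivity

theorem i2CH_neg {k : ℝ} (hk : 0 < k) : i2CH k < 0 := by
  rw [i2CH_eq, neg_div, neg_lt_zero]
  positivity

theorem i2CH_mul_i4CH_div_i3CH_neg {k : ℝ} (hk : 0 < k) : i2CH k * i4CH k / i3CH k < 0 :=
  div_neg_of_neg_of_pos (mul_neg_of_neg_of_pos (i2CH_neg hk) (i4CH_pos hk)) (i3CH_pos hk)

theorem deltaCH_eq (k : ℝ) : deltaCH k = i1CH k * (i2CH k * i4CH k / i3CH k) := by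
  rw [deltaCH]
  ring

theorem i1CH_neg {k : ℝ} (hk : 0 < k) (hk6 : k < 6) : i1CH k < 0 := by
  rw [i1CH_eq]
  exact div_neg_of_neg_of_pos (mul_neg_of_pos_of_neg (by positivity) (by nlinarith))
    (by positivity)

theorem i1CH_pos {k : ℝ} (hk : 6 < k) : 0 < i1CH k := by
  rw [i1CH_eq]
  exact div_pos (mul_pos (by linarith) (by nlinarith)) (by positivity)

/-- `i₂ i₄ / i₃ < 0` for every `k > 0`, and consequently `Δ_CH(k) > 0` for `0 < k < 6`
and `Δ_CH(k) < 0` for `k > 6`: a sufficiently small `2π/k`-periodic traveling wave of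
the Camassa–Holm equation is modulationally unstable if `k > 6`. -/
theorem deltaCH_sign :
    (∀ k : ℝ, 0 < k → i2CH k * i4CH k / i3CH k < 0) ∧
    (∀ k : ℝ, 0 < k → k < 6 → 0 < deltaCH k) ∧
    (∀ k : ℝ, 6 < k → deltaCH k < 0) := by
  refine ⟨fun k hk => i2CH_mul_i4CH_div_i3CH_neg hk, fun k hk hk6 => ?_, fun k hk => ?_⟩
  · rw [deltaCH_eq]
    exact mul_pos_of_neg_of_neg (i1CH_neg hk hk6) (i2CH_mul_i4CH_div_i3CH_neg hk)
  · rw [deltaCH_eq]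
    exact mul_neg_of_pos_of_neg (i1CH_pos hk)
      (i2CH_mul_i4CH_div_i3CH_neg (by linarith))
end
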